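/- arXiv:2311.14205 — 2 statements merged into one kernel-verified Lean document; each statement's English description precedes it below -/
import Mathlib

section
/- Fix b > 0 and β > 0 with b·β > 1. With f_N(q) = (β·N)⁻¹ · log Σ_{k=0}^{N} (N choose k)·exp(β·N·(q·m_k + b·m_k²/2)) (where m_k = −1 + 2k/N) and f(q) = sup_{m∈[−1,1]} ( q·m + b·m²/2 − β⁻¹·c(m) ): the function f is differentiable at every q ≠ 0, each f_N is differentiable, and f_N'(q) → f'(q) as N → ∞ for every q ≠ 0. -/
open Finset Filter

/-- The symmetrized entropy function
`c(m) = ((1+m)/2)·log((1+m)/2) + ((1−m)/2)·log((1−m)/2)` (with `c(±1) = 0`,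
as `Real.log 0 = 0` in Lean). -/
noncomputable def cEnt (m : ℝ) : ℝ :=
  ((1 + m) / 2) * Real.log ((1 + m) / 2) + ((1 - m) / 2) * Real.log ((1 - m) / 2)

lemma continuous_cEnt : Continuous cEnt := by
  have h := Real.continuous_mul_log
  exact (h.comp (by fun_prop : Continuous fun m : ℝ => (1 + m) / 2)).add
    (h.comp (by fun_prop : Continuous fun m : ℝ => (1 - m) / 2))

lemma cEnt_neg (m : ℝ) : cEnt (-m) = cEnt m := by
  simp only [cEnt, sub_neg_eq_add, ← sub_eq_add_neg]
  ring

lemma hasDerivAt_cEnt {m : ℝ} (h₁ : -1 < m) (h₂ : m < 1) :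
    HasDerivAt cEnt ((Real.log (1 + m) - Real.log (1 - m)) / 2) m := by
  have hp : HasDerivAt (fun m : ℝ => (1 + m) / 2) (1 / 2) m :=
    ((hasDerivAt_id m).const_add 1).div_const 2
  have hn : HasDerivAt (fun m : ℝ => (1 - m) / 2) (-1 / 2) m :=
    ((hasDerivAt_id m).const_sub 1).div_const 2
  have hlp := (Real.hasDerivAt_mul_log (x := (1 + m) / 2) (by linarith)).comp m hp
  have hln := (Real.hasDerivAt_mul_log (x := (1 - m) / 2) (by linarith)).comp m hn
  refine (hlp.add hln).congr_deriv ?_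
  rw [Real.log_div (by linarith) two_ne_zero, Real.log_div (by linarith) two_ne_zero]
  ring

lemma log_sub_log_div_le {x y : ℝ} (hx : 0 < x) (hxy : x ≤ y) (hy : y < 1) :
    (Real.log (1 + x) - Real.log (1 - x)) / x ≤ (Real.log (1 + y) - Real.log (1 - y)) / y := by
  have hy0 : 0 < y := hx.trans_le hxy
  have hsx := (Real.hasSum_log_sub_log_of_abs_lt_one
    (x := x) (abs_lt.2 ⟨by linarith, by linarith⟩)).div_const x
  have hsy := (Real.hasSum_log_sub_log_of_abs_lt_one
    (x := y) (abs_lt.2 ⟨by linarith, hy⟩)).div_const y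
  refine hasSum_le (fun k => ?_) hsx hsy
  rw [pow_succ, pow_succ, ← mul_assoc, ← mul_assoc, mul_div_cancel_right₀ _ hx.ne',
    mul_div_cancel_right₀ _ hy0.ne']
  gcongr

lemma convexOn_cEnt_sqrt : ConvexOn ℝ (Set.Icc 0 1) fun t => cEnt (√t) := by
  have hd : ∀ t ∈ Set.Ioo (0 : ℝ) 1, HasDerivAt (fun t => cEnt (√t))
      ((Real.log (1 + √t) - Real.log (1 - √t)) / √t / 4) t := by
    rintro t ⟨h0, h1⟩
    have hs0 : 0 < √t := Real.sqrt_pos.2 h0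
    have hs1 : √t < 1 := by rwa [Real.sqrt_lt' one_pos, one_pow]
    refine ((hasDerivAt_cEnt (by linarith) hs1).comp t (Real.hasDerivAt_sqrt h0.ne')).congr_deriv ?_
    field_simp
    ring
  refine MonotoneOn.convexOn_of_deriv (convex_Icc 0 1)
    (continuous_cEnt.comp Real.continuous_sqrt).continuousOn ?_ ?_
  · rw [interior_Icc]
    exact fun t ht => (hd t ht).differentiableAt.differentiableWithinAt
  · rw [interior_Icc]
    intro s hs t ht hst
    rw [(hd s hs).deriv, (hd t ht).deriv]
    have := log_sub_log_div_le (Real.sqrt_pos.2 hs.1) (Real.sqrt_le_sqrt hst)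
      ((Real.sqrt_lt' one_pos).2 (by simpa using ht.2))
    linarith

/-- The function of the magnetization `m` whose supremum is the limiting free energy. -/
noncomputable def magnetizationObjective (b β q m : ℝ) : ℝ :=
  q * m + b * m ^ 2 / 2 - β⁻¹ * cEnt m

lemma continuous_magnetizationObjective (b β q : ℝ) :
    Continuous (magnetizationObjective b β q) := by
  have := continuous_cEnt
  unfold magnetizationObjective
  fun_prop

lemma magnetizationObjective_neg_neg (b β q m : ℝ) :
    magnetizationObjective b β (-q) (-m) = magnetizationObjective b β q m := by
  simp only [magnetizationObjective, cEnt_neg]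
  ring

lemma strictConcaveOn_magnetizationObjective_sqrt {b β q : ℝ} (hβ : 0 < β) (hq : 0 < q) :
    StrictConcaveOn ℝ (Set.Icc 0 1) fun t => magnetizationObjective b β q (√t) := by
  have h1 : StrictConcaveOn ℝ (Set.Icc (0 : ℝ) 1) fun t => √t :=
    Real.strictConcaveOn_sqrt.subset Set.Icc_subset_Ici_self (convex_Icc 0 1)
  have h2 := convexOn_cEnt_sqrt
  refine ⟨convex_Icc 0 1, fun x hx y hy hxy u v hu hv huv => ?_⟩
  have e1 := mul_lt_mul_of_pos_left (h1.2 hx hy hxy hu hv huv) hq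
  have e2 := mul_le_mul_of_nonneg_left (h2.2 hx hy hu.le hv.le huv) (inv_pos.2 hβ).le
  have hz : 0 ≤ u * x + v * y := by have := hx.1; have := hy.1; positivity
  simp only [magnetizationObjective, smul_eq_mul] at *
  rw [Real.sq_sqrt hx.1, Real.sq_sqrt hy.1, Real.sq_sqrt hz]
  linarith

lemma nonneg_of_isMaxOn {b β q m : ℝ} (hq : 0 < q) (hm : m ∈ Set.Icc (-1 : ℝ) 1)
    (h : IsMaxOn (magnetizationObjective b β q) (Set.Icc (-1) 1) m) : 0 ≤ m := by
  have := h (show -m ∈ Set.Icc (-1 : ℝ) 1 from ⟨by linarith [hm.2], by linarith [hm.1]⟩)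
  simp only [magnetizationObjective, Set.mem_ofPred_eq, cEnt_neg] at this
  by_contra! hneg
  nlinarith [mul_pos_of_neg_of_neg (neg_lt_zero.2 hq) hneg]

lemma isMaxOn_sq_of_isMaxOn {b β q m : ℝ} (hq : 0 < q) (hm : m ∈ Set.Icc (-1 : ℝ) 1)
    (h : IsMaxOn (magnetizationObjective b β q) (Set.Icc (-1) 1) m) :
    IsMaxOn (fun t => magnetizationObjective b β q (√t)) (Set.Icc 0 1) (m ^ 2) := by
  intro t ht
  simp only [Set.mem_ofPred_eq]
  rw [Real.sqrt_sq (nonneg_of_isMaxOn hq hm h)]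
  exact h ⟨by linarith [Real.sqrt_nonneg t], Real.sqrt_le_one.2 ht.2⟩

lemma isMaxOn_unique_of_pos {b β q m n : ℝ} (hβ : 0 < β) (hq : 0 < q)
    (hm : m ∈ Set.Icc (-1 : ℝ) 1) (hn : n ∈ Set.Icc (-1 : ℝ) 1)
    (hmax : IsMaxOn (magnetizationObjective b β q) (Set.Icc (-1) 1) m)
    (hnax : IsMaxOn (magnetizationObjective b β q) (Set.Icc (-1) 1) n) : m = n := by
  have hm0 := nonneg_of_isMaxOn hq hm hmax
  have hn0 := nonneg_of_isMaxOn hq hn hnax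
  have hsq := (strictConcaveOn_magnetizationObjective_sqrt hβ hq).eq_of_isMaxOn
    (isMaxOn_sq_of_isMaxOn hq hm hmax) (isMaxOn_sq_of_isMaxOn hq hn hnax)
    ⟨sq_nonneg m, pow_le_one₀ hm0 hm.2⟩ ⟨sq_nonneg n, pow_le_one₀ hn0 hn.2⟩
  exact (pow_left_inj₀ hm0 hn0 two_ne_zero).1 hsq

lemma isMaxOn_neg {b β q m : ℝ}
    (h : IsMaxOn (magnetizationObjective b β q) (Set.Icc (-1) 1) m) :
    IsMaxOn (magnetizationObjective b β (-q)) (Set.Icc (-1) 1) (-m) := by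
  intro x hx
  have := h (show -x ∈ Set.Icc (-1 : ℝ) 1 from ⟨by linarith [hx.2], by linarith [hx.1]⟩)
  simp only [Set.mem_ofPred_eq] at this ⊢
  rwa [← magnetizationObjective_neg_neg, neg_neg, ← magnetizationObjective_neg_neg b β q m] at this

lemma isMaxOn_unique {b β q m n : ℝ} (hβ : 0 < β) (hq : q ≠ 0)
    (hm : m ∈ Set.Icc (-1 : ℝ) 1) (hn : n ∈ Set.Icc (-1 : ℝ) 1)
    (hmax : IsMaxOn (magnetizationObjective b β q) (Set.Icc (-1) 1) m)
    (hnax : IsMaxOn (magnetizationObjective b β q) (Set.Icc (-1) 1) n) : m = n := by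
  rcases hq.lt_or_gt with hneg | hpos
  · exact neg_injective (isMaxOn_unique_of_pos hβ (neg_pos.2 hneg)
      ⟨by linarith [hm.2], by linarith [hm.1]⟩ ⟨by linarith [hn.2], by linarith [hn.1]⟩
      (isMaxOn_neg hmax) (isMaxOn_neg hnax))
  · exact isMaxOn_unique_of_pos hβ hpos hm hn hmax hnax

/-- Danskin's theorem for a linear perturbation on the line: the maximum over `K` of `g m + h * m`
is differentiable in `h` at `0` when `g` has a unique maximizer. -/
lemma hasDerivAt_of_isLUB_of_isMaxOn_unique {K : Set ℝ} (hK : IsCompact K) {g F : ℝ → ℝ}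
    (hg : ContinuousOn g K) {q m : ℝ} (hm : m ∈ K)
    (hF : ∀ x, IsLUB ((fun n => g n + (x - q) * n) '' K) (F x))
    (hmax : IsMaxOn g K m) (huniq : ∀ n ∈ K, IsMaxOn g K n → n = m) :
    HasDerivAt F m q := by
  have hFq : F q = g m := by
    refine (hF q).unique (IsGreatest.isLUB ⟨⟨m, hm, by simp⟩, ?_⟩)
    rintro _ ⟨n, hn, rfl⟩
    simpa using hmax hn
  rw [hasDerivAt_iff_isLittleO, Asymptotics.isLittleO_iff]
  intro ε hε
  obtain ⟨δ, hδ, hgap⟩ : ∃ δ > 0, ∀ n ∈ K, ε ≤ |n - m| → g n + δ * |n - m| ≤ g m := by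
    have hK' : IsCompact (K ∩ {n | ε ≤ |n - m|}) :=
      hK.inter_right (isClosed_le continuous_const (by fun_prop))
    rcases (K ∩ {n | ε ≤ |n - m|}).eq_empty_or_nonempty with he | hne
    · exact ⟨1, one_pos, fun n hn hε' => (he.subset ⟨hn, hε'⟩).elim⟩
    have hcont : ContinuousOn (fun n => (g m - g n) / |n - m|) (K ∩ {n | ε ≤ |n - m|}) :=
      (continuousOn_const.sub (hg.mono Set.inter_subset_left)).div (by fun_prop)
        fun n hn => (hε.trans_le hn.2).ne'
    obtain ⟨n₀, hn₀, hmin⟩ := hK'.exists_isMinOn hne hcont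
    have hlt : g n₀ < g m := by
      refine (hmax hn₀.1).lt_of_ne fun heq => ?_
      have := huniq n₀ hn₀.1 fun x hx => (hmax hx).trans_eq heq.symm
      have := hn₀.2
      simp_all [hε.not_ge]
    refine ⟨_, div_pos (sub_pos.2 hlt) (hε.trans_le hn₀.2), fun n hn hεn => ?_⟩
    have := (le_div_iff₀ (hε.trans_le hεn)).1 (hmin ⟨hn, hεn⟩)
    linarith
  filter_upwards [Metric.ball_mem_nhds q hδ] with x hx
  rw [Metric.mem_ball, Real.dist_eq] at hx
  rw [Real.norm_eq_abs, Real.norm_eq_abs, smul_eq_mul, hFq, abs_of_nonneg]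
  · have : F x ≤ g m + (x - q) * m + ε * |x - q| := by
      refine (hF x).2 ?_
      rintro _ ⟨n, hn, rfl⟩
      have h1 : (x - q) * (n - m) ≤ |x - q| * |n - m| := by
        rw [← abs_mul]
        exact le_abs_self _
      rcases le_total ε |n - m| with h | h
      · have := hgap n hn h
        have := mul_le_mul_of_nonneg_right hx.le (abs_nonneg (n - m))
        have := mul_nonneg hε.le (abs_nonneg (x - q))
        simp only
        linarith
      · have h2 : g n ≤ g m := hmax hn
        have := mul_le_mul_of_nonneg_left h (abs_nonneg (x - q))
        simp only
        linarith
    linarith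
  · have := (hF x).1 ⟨m, hm, rfl⟩
    simp only at this
    linarith

lemma mul_sub_mul_log_le {p a s : ℝ} (hp : 0 ≤ p) (ha : 0 < a) (hs : 0 < s) :
    p * Real.log a - p * Real.log p ≤ a / s - p + p * Real.log s := by
  rcases hp.eq_or_lt with rfl | hp
  · simp only [zero_mul, sub_zero, add_zero]
    positivity
  have h := mul_le_mul_of_nonneg_left
    (Real.log_le_sub_one_of_pos (show 0 < a / (p * s) by positivity)) hp.le
  rw [Real.log_div ha.ne' (by positivity), Real.log_mul hp.ne' hs.ne'] at h
  have : p * (a / (p * s) - 1) = a / s - p := by field_simp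
  linarith

/-- The Legendre–Fenchel inequality between `cEnt` and `x ↦ log (2 cosh x)`. -/
lemma mul_sub_cEnt_le {m : ℝ} (hm : m ∈ Set.Icc (-1 : ℝ) 1) (x : ℝ) :
    x * m - cEnt m ≤ Real.log (Real.exp x + Real.exp (-x)) := by
  have hs : 0 < Real.exp x + Real.exp (-x) := by positivity
  have h1 := mul_sub_mul_log_le (p := (1 + m) / 2) (by linarith [hm.1]) (Real.exp_pos x) hs
  have h2 := mul_sub_mul_log_le (p := (1 - m) / 2) (by linarith [hm.2]) (Real.exp_pos (-x)) hs
  have h3 : Real.exp x / (Real.exp x + Real.exp (-x)) +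
      Real.exp (-x) / (Real.exp x + Real.exp (-x)) = 1 := by
    rw [← add_div, div_self hs.ne']
  rw [Real.log_exp] at h1 h2
  unfold cEnt
  linarith

lemma exp_natCast_mul_log (k : ℕ) {p : ℝ} (hp : k ≠ 0 → 0 < p) :
    Real.exp (k * Real.log p) = p ^ k := by
  rcases eq_or_ne k 0 with rfl | hk
  · simp
  · rw [Real.exp_nat_mul, Real.exp_log (hp hk)]

lemma choose_mul_exp_cEnt_le_one {N k : ℕ} (hN : 1 ≤ N) (hk : k ≤ N) :
    (N.choose k : ℝ) * Real.exp (N * cEnt (-1 + 2 * k / N)) ≤ 1 := by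
  have hN0 : (0 : ℝ) < N := by exact_mod_cast hN
  obtain ⟨l, rfl⟩ := Nat.exists_eq_add_of_le hk
  set n : ℝ := ((k + l : ℕ) : ℝ) with hn
  have hkl : n = k + l := by rw [hn]; push_cast; rfl
  have e1 : (1 + (-1 + 2 * k / n)) / 2 = k / n := by ring
  have e2 : (1 - (-1 + 2 * k / n)) / 2 = l / n := by
    field_simp
    rw [hkl]
    ring
  have e3 : n * cEnt (-1 + 2 * k / n) = k * Real.log (k / n) + l * Real.log (l / n) := by
    rw [cEnt, e1, e2]
    field_simp
  have hk' : k ≠ 0 → 0 < (k : ℝ) / n := fun h =>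
    div_pos (by exact_mod_cast Nat.pos_of_ne_zero h) hN0
  have hl' : l ≠ 0 → 0 < (l : ℝ) / n := fun h =>
    div_pos (by exact_mod_cast Nat.pos_of_ne_zero h) hN0
  rw [e3, Real.exp_add, exp_natCast_mul_log k hk', exp_natCast_mul_log l hl']
  have hsum : (k : ℝ) / n + l / n = 1 := by
    rw [← add_div, ← hkl, div_self hN0.ne']
  have hbin := add_pow ((k : ℝ) / n) (l / n) (k + l)
  rw [hsum, one_pow] at hbin
  rw [hbin]
  have hle := Finset.single_le_sum (s := Finset.range (k + l + 1)) (a := k)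
    (f := fun i => ((k : ℝ) / n) ^ i * (l / n) ^ (k + l - i) * ((k + l).choose i : ℝ))
    (fun i _ => by positivity) (by simp)
  rw [Nat.add_sub_cancel_left] at hle
  linarith

/-- The partition function of the Curie–Weiss model with `N` spins. -/
noncomputable def partitionFunction (b β : ℝ) (N : ℕ) (q : ℝ) : ℝ :=
  ∑ k ∈ Finset.range (N + 1), (N.choose k : ℝ) * Real.exp (β * N *
    (q * (-1 + 2 * k / N) + b * (-1 + 2 * k / N) ^ 2 / 2))

lemma partitionFunction_pos (b β : ℝ) (N : ℕ) (q : ℝ) : 0 < partitionFunction b β N q :=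
  Finset.sum_pos (fun k hk => mul_pos
    (by exact_mod_cast Nat.choose_pos (Finset.mem_range_succ_iff.1 hk)) (Real.exp_pos _))
    Finset.nonempty_range_add_one

lemma magnetization_mem_Icc {N k : ℕ} (hN : 1 ≤ N) (hk : k ≤ N) :
    -1 + 2 * (k : ℝ) / N ∈ Set.Icc (-1 : ℝ) 1 := by
  have hN0 : (0 : ℝ) < N := by exact_mod_cast hN
  have hk' : (k : ℝ) ≤ N := by exact_mod_cast hk
  have h1 : (k : ℝ) / N ≤ 1 := (div_le_one hN0).2 hk'
  have h0 : 0 ≤ (k : ℝ) / N := by positivity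
  rw [mul_div_assoc]
  exact ⟨by linarith, by linarith⟩

lemma log_partitionFunction_le {b β q F : ℝ} (hβ : 0 < β) {N : ℕ} (hN : 1 ≤ N)
    (hF : ∀ m ∈ Set.Icc (-1 : ℝ) 1, magnetizationObjective b β q m ≤ F) :
    Real.log (partitionFunction b β N q) ≤ Real.log (N + 1) + β * N * F := by
  have hN0 : (0 : ℝ) < N := by exact_mod_cast hN
  rw [Real.log_le_iff_le_exp (partitionFunction_pos b β N q), Real.exp_add,
    Real.exp_log (by positivity)]
  have hterm : ∀ k ∈ Finset.range (N + 1), (N.choose k : ℝ) * Real.exp (β * N *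
      (q * (-1 + 2 * k / N) + b * (-1 + 2 * k / N) ^ 2 / 2)) ≤ Real.exp (β * N * F) := by
    intro k hk
    have hk' := Finset.mem_range_succ_iff.1 hk
    have h1 := hF _ (magnetization_mem_Icc hN hk')
    set m := -1 + 2 * (k : ℝ) / N
    have e : β * N * (q * m + b * m ^ 2 / 2)
        = N * cEnt m + β * N * magnetizationObjective b β q m := by
      unfold magnetizationObjective
      field_simp
      ring
    rw [e, Real.exp_add, ← mul_assoc]
    calc _ ≤ 1 * Real.exp (β * N * magnetizationObjective b β q m) := by
          gcongr
          exact choose_mul_exp_cEnt_le_one hN hk'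
      _ ≤ _ := by
          rw [one_mul]
          gcongr
  refine (Finset.sum_le_card_nsmul _ _ _ hterm).trans_eq ?_
  simp

lemma le_log_partitionFunction {b β q m : ℝ} (hb : 0 < b) (hβ : 0 < β) {N : ℕ} (hN : 1 ≤ N)
    (hm : m ∈ Set.Icc (-1 : ℝ) 1) :
    β * N * magnetizationObjective b β q m ≤ Real.log (partitionFunction b β N q) := by
  have hN0 : (0 : ℝ) < N := by exact_mod_cast hN
  set x := β * (q + b * m) with hx
  have hs : 0 < Real.exp x + Real.exp (-x) := by positivity
  have hZ : Real.exp (-(β * N * (b * m ^ 2 / 2))) * (Real.exp x + Real.exp (-x)) ^ N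
      ≤ partitionFunction b β N q := by
    rw [add_pow, Finset.mul_sum]
    refine Finset.sum_le_sum fun k hk => ?_
    have hk' := Finset.mem_range_succ_iff.1 hk
    rw [← Real.exp_nat_mul, ← Real.exp_nat_mul, ← Real.exp_add, ← mul_assoc, ← Real.exp_add,
      mul_comm, Nat.cast_sub hk']
    gcongr
    have e : (k : ℝ) * x + (N - k) * -x = N * x * (-1 + 2 * k / N) := by
      field_simp
      ring
    rw [e, hx]
    have := mul_nonneg (by positivity : 0 ≤ β * N * b / 2) (sq_nonneg (-1 + 2 * (k : ℝ) / N - m))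
    linarith
  refine le_trans ?_ (Real.log_le_log (by positivity) hZ)
  rw [Real.log_mul (by positivity) (by positivity), Real.log_exp, Real.log_pow]
  have h := mul_le_mul_of_nonneg_left (mul_sub_cEnt_le hm x) hN0.le
  refine le_trans (le_of_eq ?_) (add_le_add_right h _)
  rw [hx]
  unfold magnetizationObjective
  field_simp
  ring

lemma hasDerivAt_log_sum_exp {ι : Type*} {s : Finset ι} (hs : s.Nonempty) {a : ι → ℝ}
    (ha : ∀ i ∈ s, 0 < a i) (y : ι → ℝ) (q : ℝ) :
    HasDerivAt (fun q => Real.log (∑ i ∈ s, a i * Real.exp (q * y i)))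
      ((∑ i ∈ s, a i * Real.exp (q * y i) * y i) / ∑ i ∈ s, a i * Real.exp (q * y i)) q := by
  have hpos : 0 < ∑ i ∈ s, a i * Real.exp (q * y i) :=
    Finset.sum_pos (fun i hi => mul_pos (ha i hi) (Real.exp_pos _)) hs
  refine HasDerivAt.log ?_ hpos.ne'
  refine HasDerivAt.fun_sum fun i _ => ?_
  refine ((((hasDerivAt_id q).mul_const (y i)).exp).const_mul (a i)).congr_deriv ?_
  simp only [id]
  ring

lemma deriv_log_sum_exp_mul_le {ι : Type*} {s : Finset ι} (hs : s.Nonempty) {a : ι → ℝ}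
    (ha : ∀ i ∈ s, 0 < a i) (y : ι → ℝ) (q h : ℝ) :
    deriv (fun q => Real.log (∑ i ∈ s, a i * Real.exp (q * y i))) q * h ≤
      Real.log (∑ i ∈ s, a i * Real.exp ((q + h) * y i)) -
        Real.log (∑ i ∈ s, a i * Real.exp (q * y i)) := by
  have hpos : ∀ q, 0 < ∑ i ∈ s, a i * Real.exp (q * y i) := fun q =>
    Finset.sum_pos (fun i hi => mul_pos (ha i hi) (Real.exp_pos _)) hs
  rw [(hasDerivAt_log_sum_exp hs ha y q).deriv, ← Real.log_div (hpos _).ne' (hpos _).ne',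
    Real.le_log_iff_exp_le (div_pos (hpos _) (hpos _))]
  have hw : ∑ i ∈ s, a i * Real.exp (q * y i) / ∑ i ∈ s, a i * Real.exp (q * y i) = 1 := by
    rw [← Finset.sum_div, div_self (hpos q).ne']
  have hJ := convexOn_exp.map_sum_le (t := s) (p := fun i => y i * h)
    (fun i hi => div_nonneg (mul_nonneg (ha i hi).le (Real.exp_pos _).le) (hpos q).le) hw
    fun i _ => Set.mem_univ _
  refine (le_of_eq ?_).trans (hJ.trans_eq ?_)
  · rw [Finset.sum_div, Finset.sum_mul]
    congr 1
    refine Finset.sum_congr rfl fun i _ => ?_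
    rw [smul_eq_mul]
    ring
  · rw [Finset.sum_div]
    refine Finset.sum_congr rfl fun i _ => ?_
    rw [smul_eq_mul, add_mul, Real.exp_add, mul_comm h]
    ring

/-- Subgradients of a pointwise convergent sequence of functions converge to the derivative of the
limit. -/
lemma tendsto_of_subgradient {F : ℕ → ℝ → ℝ} {f : ℝ → ℝ} {D : ℕ → ℝ} {f' q : ℝ}
    (hD : ∀ᶠ N in atTop, ∀ h, D N * h ≤ F N (q + h) - F N q)
    (hF : ∀ x, Tendsto (fun N => F N x) atTop (nhds (f x))) (hf : HasDerivAt f f' q) :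
    Tendsto D atTop (nhds f') := by
  rw [Metric.tendsto_nhds]
  intro ε hε
  rw [hasDerivAt_iff_isLittleO, Asymptotics.isLittleO_iff] at hf
  obtain ⟨δ, hδ, hball⟩ := Metric.eventually_nhds_iff.1 (hf (show 0 < ε / 2 by positivity))
  have key : ∀ h, |h| = δ / 2 → ∀ᶠ N in atTop, (D N - f') * h < ε * (δ / 2) := by
    intro h hh
    have hx := hball (y := q + h) (by rw [Real.dist_eq, add_sub_cancel_left, hh]; linarith)
    rw [add_sub_cancel_left, Real.norm_eq_abs, Real.norm_eq_abs, smul_eq_mul, hh] at hx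
    have hlim : f (q + h) - f q < f' * h + ε * (δ / 2) := by
      have := (abs_le.1 hx).2
      have : 0 < ε * (δ / 2) := by positivity
      linarith
    filter_upwards [hD, ((hF (q + h)).sub (hF q)).eventually_lt_const hlim] with N h1 h2
    linarith [h1 h]
  have hδ2 : 0 < δ / 2 := by positivity
  filter_upwards [key (δ / 2) (abs_of_pos hδ2), key (-(δ / 2)) (by rw [abs_neg, abs_of_pos hδ2])]
    with N h1 h2
  rw [Real.dist_eq, abs_lt]
  constructor <;> nlinarith

lemma partitionFunction_eq_sum_exp (b β : ℝ) (N : ℕ) (q : ℝ) :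
    partitionFunction b β N q = ∑ k ∈ Finset.range (N + 1),
      ((N.choose k : ℝ) * Real.exp (β * N * (b * (-1 + 2 * k / N) ^ 2 / 2))) *
        Real.exp (q * (β * N * (-1 + 2 * k / N))) := by
  refine Finset.sum_congr rfl fun k _ => ?_
  rw [mul_assoc (N.choose k : ℝ), ← Real.exp_add]
  ring_nf

lemma isLUB_image_magnetizationObjective {b β : ℝ} {f : ℝ → ℝ}
    (hf : ∀ q, f q = sSup (magnetizationObjective b β q '' Set.Icc (-1) 1)) (q : ℝ) :
    IsLUB (magnetizationObjective b β q '' Set.Icc (-1) 1) (f q) := by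
  rw [hf]
  exact isLUB_csSup ((Set.nonempty_Icc.2 (by norm_num)).image _)
    (isCompact_Icc.image (continuous_magnetizationObjective b β q)).bddAbove

lemma differentiableAt_sSup_magnetizationObjective {b β q : ℝ} (hβ : 0 < β) (hq : q ≠ 0)
    {f : ℝ → ℝ} (hf : ∀ q, f q = sSup (magnetizationObjective b β q '' Set.Icc (-1) 1)) :
    DifferentiableAt ℝ f q := by
  have hcont := (continuous_magnetizationObjective b β q).continuousOn (s := Set.Icc (-1) 1)
  obtain ⟨m, hm, hmax⟩ := isCompact_Icc.exists_isMaxOn (Set.nonempty_Icc.2 (by norm_num)) hcont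
  refine (hasDerivAt_of_isLUB_of_isMaxOn_unique isCompact_Icc hcont hm (fun x => ?_) hmax
    fun n hn hnax => isMaxOn_unique hβ hq hn hm hnax hmax).differentiableAt
  convert isLUB_image_magnetizationObjective hf x using 3 with n
  unfold magnetizationObjective
  ring

lemma tendsto_log_partitionFunction {b β q : ℝ} (hb : 0 < b) (hβ : 0 < β)
    {F : ℝ} (hF : IsLUB (magnetizationObjective b β q '' Set.Icc (-1) 1) F) :
    Tendsto (fun N : ℕ => (β * N)⁻¹ * Real.log (partitionFunction b β N q)) atTop (nhds F) := by
  have hlog : Tendsto (fun N : ℕ => β⁻¹ * (Real.log ((N : ℝ) + 1) / N) + F) atTop (nhds F) := by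
    have h1 : Tendsto (fun N : ℕ => Real.log ((N : ℝ) + 1) / N) atTop (nhds 0) := by
      have := (Real.tendsto_pow_log_div_mul_add_atTop 1 (-1) 1 one_ne_zero).comp
        (tendsto_natCast_atTop_atTop.atTop_add (tendsto_const_nhds (x := (1 : ℝ))))
      simpa [Function.comp_def] using this
    simpa using (h1.const_mul β⁻¹).add_const F
  refine tendsto_of_tendsto_of_tendsto_of_le_of_le' tendsto_const_nhds hlog ?_ ?_
  · filter_upwards [eventually_ge_atTop 1] with N hN
    refine hF.2 ?_
    rintro _ ⟨m, hm, rfl⟩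
    have hN0 : (0 : ℝ) < N := by exact_mod_cast hN
    rw [le_inv_mul_iff₀ (by positivity)]
    exact le_log_partitionFunction hb hβ hN hm
  · filter_upwards [eventually_ge_atTop 1] with N hN
    have hN0 : (0 : ℝ) < N := by exact_mod_cast hN
    rw [inv_mul_le_iff₀ (by positivity)]
    refine (log_partitionFunction_le hβ hN fun m hm => hF.1 ⟨m, hm, rfl⟩).trans_eq ?_
    field_simp

/-- `f` is differentiable away from `0`, each `f_N` is
differentiable, and `f_N'(q) → f'(q)` for every `q ≠ 0` as `N → ∞`. -/
theorem curie_weiss_free_energy_deriv_convergence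
    (b β : ℝ) (hb : 0 < b) (hβ : 0 < β) (hbβ : 1 < b * β)
    (fN : ℕ → ℝ → ℝ)
    (hfN : ∀ N : ℕ, 1 ≤ N → ∀ q : ℝ,
      fN N q = (β * N)⁻¹ * Real.log (∑ k ∈ Finset.range (N + 1),
        (N.choose k : ℝ) * Real.exp (β * N *
          (q * (-1 + 2 * k / N) + b * (-1 + 2 * k / N) ^ 2 / 2))))
    (f : ℝ → ℝ)
    (hf : ∀ q : ℝ, f q = sSup ((fun m => q * m + b * m ^ 2 / 2 - β⁻¹ * cEnt m) ''
      Set.Icc (-1 : ℝ) 1)) :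
    (∀ q : ℝ, q ≠ 0 → DifferentiableAt ℝ f q) ∧
    (∀ N : ℕ, 1 ≤ N → Differentiable ℝ (fN N)) ∧
    (∀ q : ℝ, q ≠ 0 →
      Tendsto (fun N => deriv (fN N) q) atTop (nhds (deriv f q))) := by
  replace hfN : ∀ N : ℕ, 1 ≤ N →
      fN N = fun q => (β * N)⁻¹ * Real.log (partitionFunction b β N q) :=
    fun N hN => funext (hfN N hN)
  have ha : ∀ N : ℕ, ∀ k ∈ Finset.range (N + 1),
      0 < (N.choose k : ℝ) * Real.exp (β * N * (b * (-1 + 2 * k / N) ^ 2 / 2)) :=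
    fun N k hk => mul_pos (by exact_mod_cast Nat.choose_pos (Finset.mem_range_succ_iff.1 hk))
      (Real.exp_pos _)
  have hdiff : ∀ N : ℕ, Differentiable ℝ fun q => Real.log (partitionFunction b β N q) := by
    intro N q
    simp only [partitionFunction_eq_sum_exp]
    exact (hasDerivAt_log_sum_exp Finset.nonempty_range_add_one (ha N) _ q).differentiableAt
  have hdf : ∀ q : ℝ, q ≠ 0 → DifferentiableAt ℝ f q := fun q hq =>
    differentiableAt_sSup_magnetizationObjective hβ hq hf
  refine ⟨hdf, fun N hN => ?_, fun q hq => ?_⟩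
  · rw [hfN N hN]
    exact (hdiff N).const_mul _
  · refine tendsto_of_subgradient (F := fN) ?_ (fun x => ?_) (hdf q hq).hasDerivAt
    · filter_upwards [eventually_ge_atTop 1] with N hN h
      rw [hfN N hN, deriv_const_mul _ (hdiff N q), mul_assoc, ← mul_sub]
      refine mul_le_mul_of_nonneg_left ?_ (by positivity)
      simp only [partitionFunction_eq_sum_exp]
      exact deriv_log_sum_exp_mul_le Finset.nonempty_range_add_one (ha N) _ q h
    · refine (tendsto_log_partitionFunction hb hβ
        (isLUB_image_magnetizationObjective hf x)).congr' ?_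
      filter_upwards [eventually_ge_atTop 1] with N hN
      rw [hfN N hN]
end

section
/- Fix a smooth function u : [−1,1] → (0,1/2), a smooth function F : (−1,1) → ℝ, and a smooth positive function ρ : [−1,1] → (0,∞). For N ≥ 2 and 1 ≤ i ≤ N+1 write m_i = −1 + 2(i−1)/N, and define the (N+1)×(N+1) matrices: K_N = (k_{ij}) tridiagonal symmetric with k_{i,i+1} = k_{i+1,i} = u(m_{i+1}); ρ̂ with entries ρ̂_{ij} = ℓ(ρ(m_i), ρ(m_j)) where ℓ is the logarithmic mean; and (∇F)_{ij} = (N/2)·(F(m_i) − F(m_j)). Define the discrete divergence (∇∇ A)_i = −(N/2)·Σ_j k_{ij}·a_{ij} for antisymmetric A = (a_{ij}). Then for every compact interval Kc ⊂ (−1,1) there exists C > 0 such that for all N and all indices i with 2 ≤ i ≤ N and m_i ∈ Kc, | [∇∇( ρ̂ ⊙ ∇F )]_i − ( u·ρ·F' )'(m_i) | ≤ C/N, where ⊙ denotes the entrywise (Hadamard) product of matrices. (Thus the discrete Fokker–Planck drift term converges to (u·ρ·F')' at rate O(1/N).) -/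
open Finset

/-- The logarithmic mean: `ℓ(x,y) = (x−y)/(log x − log y)` for `x ≠ y`,
and `ℓ(x,x) = x`. -/
noncomputable def logMean (x y : ℝ) : ℝ :=
  if x = y then x else (x - y) / (Real.log x - Real.log y)

/-- The grid point `m_i = −1 + 2(i−1)/N` (1-based index `i`). -/
noncomputable def mpt (N i : ℕ) : ℝ := -1 + 2 * ((i : ℝ) - 1) / N

/-- The tridiagonal symmetric matrix `K_N` with off-diagonal entries
`k_{i,i+1} = k_{i+1,i} = u(m_{i+1})` and diagonal entries `k_{11} = 1 − u(m₂)`,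
`k_{ii} = 1 − u(m_i) − u(m_{i+1})` for `2 ≤ i ≤ N`, `k_{N+1,N+1} = 1 − u(m_{N+1})`
(indices below are 0-based: the entry `(a,b)` is `k_{a+1,b+1}`). -/
noncomputable def Kmat (u : ℝ → ℝ) (N : ℕ) : Matrix (Fin (N + 1)) (Fin (N + 1)) ℝ :=
  fun a b =>
    if (b : ℕ) = (a : ℕ) + 1 then u (mpt N ((a : ℕ) + 2))
    else if (a : ℕ) = (b : ℕ) + 1 then u (mpt N ((b : ℕ) + 2))
    else if a = b then
      (if (a : ℕ) = 0 then 1 - u (mpt N 2)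
       else if (a : ℕ) = N then 1 - u (mpt N (N + 1))
       else 1 - u (mpt N ((a : ℕ) + 1)) - u (mpt N ((a : ℕ) + 2)))
    else 0

/-- The matrix `ρ̂` with entries `ρ̂_{ij} = ℓ(ρ(m_i), ρ(m_j))`. -/
noncomputable def rhoHat (ρ : ℝ → ℝ) (N : ℕ) : Matrix (Fin (N + 1)) (Fin (N + 1)) ℝ :=
  fun a b => logMean (ρ (mpt N ((a : ℕ) + 1))) (ρ (mpt N ((b : ℕ) + 1)))

/-- The discrete gradient matrix `(∇F)_{ij} = (N/2)·(F(m_i) − F(m_j))`. -/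
noncomputable def gradMat (F : ℝ → ℝ) (N : ℕ) : Matrix (Fin (N + 1)) (Fin (N + 1)) ℝ :=
  fun a b => ((N : ℝ) / 2) * (F (mpt N ((a : ℕ) + 1)) - F (mpt N ((b : ℕ) + 1)))

/-- The discrete divergence `(∇∇A)_i = −(N/2)·Σ_j k_{ij}·a_{ij}`. -/
noncomputable def divg (u : ℝ → ℝ) (N : ℕ)
    (A : Matrix (Fin (N + 1)) (Fin (N + 1)) ℝ) : Fin (N + 1) → ℝ :=
  fun a => -((N : ℝ) / 2) * ∑ b, Kmat u N a b * A a b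

/-- For `c ≤ x, y`, the logarithmic mean differs from the arithmetic mean by at most
`(x - y)² / (4c)`. -/
theorem abs_logMean_sub_arithMean_le {c x y : ℝ} (hc : 0 < c) (hx : c ≤ x) (hy : c ≤ y) :
    |logMean x y - (x + y) / 2| ≤ (x - y) ^ 2 / (4 * c) := by
  wlog hlt : y < x generalizing x y
  · rcases (not_lt.mp hlt).eq_or_lt with h | h
    · subst h
      simp [logMean]
    · have key := this hy hx h
      have hsymm : logMean x y = logMean y x := by
        rw [logMean, logMean, if_neg h.ne, if_neg h.ne', ← neg_sub y x,
          ← neg_sub (Real.log y), neg_div_neg_eq]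
      rw [hsymm, add_comm x y, ← neg_sub y x, neg_sq]
      exact key
  have hy0 : 0 < y := hc.trans_le hy
  have hx0 : 0 < x := hc.trans_le hx
  have hd : 0 < x - y := sub_pos.mpr hlt
  have hlog : Real.log x - Real.log y = Real.log (x / y) :=
    (Real.log_div hx0.ne' hy0.ne').symm
  have hlower : 2 * (x - y) / (x + y) ≤ Real.log x - Real.log y := by
    have h := Real.le_log_one_add_of_nonneg (x := (x - y) / y) (by positivity)
    have h1 : 1 + (x - y) / y = x / y := by field_simp; ring
    have h2 : 2 * ((x - y) / y) / ((x - y) / y + 2) = 2 * (x - y) / (x + y) := by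
      have : (x - y) / y + 2 = (x + y) / y := by field_simp; ring
      rw [this]
      field_simp
    rwa [h1, h2, ← hlog] at h
  have hupper : Real.log x - Real.log y ≤ (x - y) * (x + y) / (2 * x * y) := by
    have hnonneg : 0 ≤ Real.log (x / y) := Real.log_nonneg ((one_le_div hy0).mpr hlt.le)
    have h := Real.self_le_sinh_iff.mpr hnonneg
    rw [Real.sinh_log (by positivity)] at h
    have h1 : (x / y - (x / y)⁻¹) / 2 = (x - y) * (x + y) / (2 * x * y) := by
      field_simp
      ring
    rwa [h1, ← hlog] at h
  have hpos : 0 < Real.log x - Real.log y := lt_of_lt_of_le (by positivity) hlower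
  have hle : logMean x y ≤ (x + y) / 2 := by
    rw [logMean, if_neg hlt.ne', div_le_iff₀ hpos]
    rw [div_le_iff₀ (by positivity)] at hlower
    linarith
  have hge : 2 * x * y / (x + y) ≤ logMean x y := by
    rw [logMean, if_neg hlt.ne', le_div_iff₀ hpos]
    calc 2 * x * y / (x + y) * (Real.log x - Real.log y)
        ≤ 2 * x * y / (x + y) * ((x - y) * (x + y) / (2 * x * y)) := by gcongr
      _ = x - y := by field_simp
  rw [abs_le]
  have hmeans : (x + y) / 2 - 2 * x * y / (x + y) ≤ (x - y) ^ 2 / (4 * c) := by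
    have h1 : (x + y) / 2 - 2 * x * y / (x + y) = (x - y) ^ 2 / (2 * (x + y)) := by
      field_simp
      ring
    rw [h1]
    exact div_le_div_of_nonneg_left (sq_nonneg _) (by positivity) (by linarith)
  have hnn : 0 ≤ (x - y) ^ 2 / (4 * c) := by positivity
  constructor <;> linarith

/-- If the derivatives of `f` and of the comparison function `p` differ by at most `C`
on a convex set, then so do the increments, up to the factor `|y - x|`. -/
theorem abs_increment_sub_le {K : Set ℝ} (hK : Convex ℝ K) {f f' p p' : ℝ → ℝ} {C x y : ℝ}
    (hf : ∀ t ∈ K, HasDerivAt f (f' t) t) (hp : ∀ t, HasDerivAt p (p' t) t)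
    (hx : x ∈ K) (hy : y ∈ K) (hC : ∀ t ∈ K, |t - x| ≤ |y - x| → |f' t - p' t| ≤ C) :
    |f y - f x - (p y - p x)| ≤ C * |y - x| := by
  have hsub : Set.uIcc x y ⊆ K := hK.ordConnected.uIcc_subset hx hy
  have h := (convex_uIcc x y).norm_image_sub_le_of_norm_hasDerivWithin_le
    (f := fun t => f t - p t) (f' := fun t => f' t - p' t) (C := C)
    (fun t ht => ((hf t (hsub ht)).sub (hp t)).hasDerivWithinAt)
    (fun t ht => hC t (hsub ht) (Set.abs_sub_left_of_mem_uIcc ht))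
    Set.left_mem_uIcc Set.right_mem_uIcc
  simp only [Real.norm_eq_abs] at h
  convert h using 2
  ring

theorem ContDiffOn.hasDerivAt_deriv {U : Set ℝ} (hU : IsOpen U) {f : ℝ → ℝ}
    (hf : ContDiffOn ℝ (⊤ : ℕ∞) f U) {x : ℝ} (hx : x ∈ U) : HasDerivAt f (deriv f x) x :=
  ((hf.differentiableOn (by simp)).differentiableAt (hU.mem_nhds hx)).hasDerivAt

theorem IsCompact.exists_abs_le {K : Set ℝ} (hK : IsCompact K) {f : ℝ → ℝ}
    (hf : ContinuousOn f K) : ∃ C, 0 ≤ C ∧ ∀ x ∈ K, |f x| ≤ C := by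
  obtain ⟨C, hC⟩ := hK.exists_bound_of_continuousOn hf
  exact ⟨max C 0, le_max_right _ _, fun x hx => (hC x hx).trans (le_max_left _ _)⟩

/-- Taylor expansions up to second order, with uniform constants on a compact convex set. -/
theorem exists_uniform_taylor_bound {K U : Set ℝ} (hU : IsOpen U) (hK : IsCompact K)
    (hKc : Convex ℝ K) (hKU : K ⊆ U) {f : ℝ → ℝ} (hf : ContDiffOn ℝ (⊤ : ℕ∞) f U) :
    ∃ C, 0 ≤ C ∧ ∀ x ∈ K, |f x| ≤ C ∧ |deriv f x| ≤ C ∧ |deriv (deriv f) x| ≤ C ∧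
      ∀ y ∈ K, |f y - f x| ≤ C * |y - x| ∧
        |f y - f x - deriv f x * (y - x)| ≤ C * |y - x| ^ 2 ∧
        |f y - f x - (deriv f x * (y - x) + deriv (deriv f) x * (y - x) ^ 2 / 2)|
          ≤ C * |y - x| ^ 3 := by
  have hf1 := ((contDiffOn_infty_iff_deriv_of_isOpen hU).mp hf).2
  have hf2 := ((contDiffOn_infty_iff_deriv_of_isOpen hU).mp hf1).2
  have hf3 := ((contDiffOn_infty_iff_deriv_of_isOpen hU).mp hf2).2
  obtain ⟨C₀, hC₀, h₀⟩ := hK.exists_abs_le (hf.continuousOn.mono hKU)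
  obtain ⟨C₁, hC₁, h₁⟩ := hK.exists_abs_le (hf1.continuousOn.mono hKU)
  obtain ⟨C₂, hC₂, h₂⟩ := hK.exists_abs_le (hf2.continuousOn.mono hKU)
  obtain ⟨C₃, hC₃, h₃⟩ := hK.exists_abs_le (hf3.continuousOn.mono hKU)
  have d0 : ∀ t ∈ K, HasDerivAt f (deriv f t) t := fun t ht => hf.hasDerivAt_deriv hU (hKU ht)
  have d1 : ∀ t ∈ K, HasDerivAt (deriv f) (deriv (deriv f) t) t :=
    fun t ht => hf1.hasDerivAt_deriv hU (hKU ht)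
  have d2 : ∀ t ∈ K, HasDerivAt (deriv (deriv f)) (deriv (deriv (deriv f)) t) t :=
    fun t ht => hf2.hasDerivAt_deriv hU (hKU ht)
  have lipschitz : ∀ {g g' : ℝ → ℝ} {C : ℝ}, (∀ t ∈ K, HasDerivAt g (g' t) t) →
      (∀ t ∈ K, |g' t| ≤ C) → ∀ x ∈ K, ∀ y ∈ K, |g y - g x| ≤ C * |y - x| := by
    intro g g' C hg hC x hx y hy
    have h := abs_increment_sub_le hKc hg (fun t => hasDerivAt_const t (0 : ℝ)) hx hy
      (C := C) (fun t ht _ => by simpa using hC t ht)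
    simpa using h
  have linear : ∀ {g g' : ℝ → ℝ} {C : ℝ}, 0 ≤ C → (∀ t ∈ K, HasDerivAt g (g' t) t) →
      (∀ x ∈ K, ∀ y ∈ K, |g' y - g' x| ≤ C * |y - x|) →
      ∀ x ∈ K, ∀ y ∈ K, |g y - g x - g' x * (y - x)| ≤ C * |y - x| ^ 2 := by
    intro g g' C hC0 hg hC x hx y hy
    have h := abs_increment_sub_le hKc hg
      (fun t => (hasDerivAt_id t).const_mul (g' x)) hx hy (C := C * |y - x|)
      (fun t ht htx => by
        rw [mul_one]
        exact (hC x hx t ht).trans (by gcongr))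
    rw [sq, ← mul_assoc]
    convert h using 2
    simp only [id]
    ring
  refine ⟨C₀ + C₁ + C₂ + C₃, by positivity, fun x hx =>
    ⟨by linarith [h₀ x hx], by linarith [h₁ x hx], by linarith [h₂ x hx], fun y hy =>
      ⟨(lipschitz d0 h₁ x hx y hy).trans (by gcongr; linarith),
        (linear hC₂ d0 (lipschitz d1 h₂) x hx y hy).trans (by gcongr; linarith), ?_⟩⟩⟩
  have hp : ∀ t, HasDerivAt (fun t => deriv f x * (t - x) + deriv (deriv f) x * (t - x) ^ 2 / 2)
      (deriv f x + deriv (deriv f) x * (t - x)) t := by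
    intro t
    have e := (hasDerivAt_id t).sub_const x
    refine ((e.const_mul (deriv f x)).add
      (((e.pow 2).const_mul (deriv (deriv f) x)).div_const 2)).congr_deriv ?_
    simp
    ring
  have h := abs_increment_sub_le hKc d0 hp hx hy (C := C₃ * |y - x| ^ 2)
    (fun t ht htx => by
      rw [← sub_sub]
      exact (linear hC₃ d1 (lipschitz d2 h₃) x hx t ht).trans (by gcongr))
  calc _ ≤ C₃ * |y - x| ^ 2 * |y - x| := by
        convert h using 2
        ring
    _ = C₃ * |y - x| ^ 3 := by ring
    _ ≤ _ := by gcongr; linarith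

/-- `g x h = g₀ x + h * g₁ x + O(h²)` uniformly for `x ∈ s` and `0 < |h| ≤ δ`,
with bounded coefficients. -/
def UniformExpansion (s : Set ℝ) (δ : ℝ) (g : ℝ → ℝ → ℝ) (g₀ g₁ : ℝ → ℝ) : Prop :=
  ∃ C, 0 ≤ C ∧ ∀ x ∈ s, |g₀ x| ≤ C ∧ |g₁ x| ≤ C ∧
    ∀ h, h ≠ 0 → |h| ≤ δ → |g x h - g₀ x - h * g₁ x| ≤ C * h ^ 2

namespace UniformExpansion

variable {s : Set ℝ} {δ : ℝ}

theorem mul {p q : ℝ → ℝ → ℝ} {p₀ p₁ q₀ q₁ : ℝ → ℝ} (hδ : δ ≤ 1)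
    (hp : UniformExpansion s δ p p₀ p₁) (hq : UniformExpansion s δ q q₀ q₁) :
    UniformExpansion s δ (fun x h => p x h * q x h) (fun x => p₀ x * q₀ x)
      (fun x => p₀ x * q₁ x + p₁ x * q₀ x) := by
  obtain ⟨A, hA, hp⟩ := hp
  obtain ⟨B, hB, hq⟩ := hq
  refine ⟨9 * (A * B), by positivity, fun x hx => ?_⟩
  obtain ⟨hp0, hp1, hpe⟩ := hp x hx
  obtain ⟨hq0, hq1, hqe⟩ := hq x hx
  have hAB : 0 ≤ A * B := by positivity
  have b00 : |p₀ x * q₀ x| ≤ A * B := by rw [abs_mul]; gcongr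
  have b01 : |p₀ x * q₁ x| ≤ A * B := by rw [abs_mul]; gcongr
  have b10 : |p₁ x * q₀ x| ≤ A * B := by rw [abs_mul]; gcongr
  have b11 : |p₁ x * q₁ x| ≤ A * B := by rw [abs_mul]; gcongr
  refine ⟨by linarith, (abs_add_le _ _).trans (by linarith), fun h h0 hh => ?_⟩
  have hpe := hpe h h0 hh
  have hqe := hqe h h0 hh
  have hh1 : |h| ≤ 1 := hh.trans hδ
  have hsq : h ^ 2 ≤ 1 := by rw [← sq_abs]; exact pow_le_one₀ (abs_nonneg h) hh1
  have hlin : ∀ {a b M : ℝ}, |a| ≤ M → |b| ≤ M → |a + h * b| ≤ 2 * M := by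
    intro a b M ha hb
    have h1 : |h * b| ≤ M := by
      rw [abs_mul]
      exact (mul_le_of_le_one_left (abs_nonneg b) hh1).trans hb
    exact (abs_add_le _ _).trans (by linarith)
  have hqb : |q x h| ≤ 3 * B := by
    have h1 : q x h = (q x h - q₀ x - h * q₁ x) + (q₀ x + h * q₁ x) := by ring
    rw [h1]
    have h2 : B * h ^ 2 ≤ B := mul_le_of_le_one_right hB hsq
    exact (abs_add_le _ _).trans (by linarith [hlin hq0 hq1])
  have hsplit : p x h * q x h - p₀ x * q₀ x - h * (p₀ x * q₁ x + p₁ x * q₀ x)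
      = (p x h - p₀ x - h * p₁ x) * q x h
        + (p₀ x + h * p₁ x) * (q x h - q₀ x - h * q₁ x) + h ^ 2 * (p₁ x * q₁ x) := by ring
  rw [hsplit]
  calc _ ≤ |p x h - p₀ x - h * p₁ x| * |q x h|
        + |p₀ x + h * p₁ x| * |q x h - q₀ x - h * q₁ x| + h ^ 2 * |p₁ x * q₁ x| := by
        refine (abs_add_three _ _ _).trans_eq ?_
        rw [abs_mul, abs_mul, abs_mul (h ^ 2), abs_of_nonneg (sq_nonneg h)]
    _ ≤ A * h ^ 2 * (3 * B) + 2 * A * (B * h ^ 2) + h ^ 2 * (A * B) := by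
        gcongr
        exact hlin hp0 hp1
    _ ≤ _ := by nlinarith [mul_nonneg hAB (sq_nonneg h)]

variable {K U : Set ℝ} {f : ℝ → ℝ}

theorem of_shift (hU : IsOpen U) (hK : IsCompact K) (hKc : Convex ℝ K) (hKU : K ⊆ U)
    (hsK : s ⊆ K) (hδK : ∀ x ∈ s, ∀ h, |h| ≤ δ → x + h ∈ K)
    (hf : ContDiffOn ℝ (⊤ : ℕ∞) f U) :
    UniformExpansion s δ (fun x h => f (x + h)) f (deriv f) := by
  obtain ⟨C, hC, hb⟩ := exists_uniform_taylor_bound hU hK hKc hKU hf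
  refine ⟨C, hC, fun x hx => ?_⟩
  obtain ⟨h0, h1, -, hT⟩ := hb x (hsK hx)
  refine ⟨h0, h1, fun h _ hh => ?_⟩
  have := (hT _ (hδK x hx h hh)).2.1
  rwa [add_sub_cancel_left, sq_abs, mul_comm (deriv f x)] at this

theorem of_const (hK : IsCompact K) (hKU : K ⊆ U) (hsK : s ⊆ K)
    (hf : ContDiffOn ℝ (⊤ : ℕ∞) f U) :
    UniformExpansion s δ (fun x _ => f x) f 0 := by
  obtain ⟨C, hC, hb⟩ := hK.exists_abs_le (hf.continuousOn.mono hKU)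
  exact ⟨C, hC, fun x hx => ⟨hb x (hsK hx), by simpa using hC, fun h _ _ => by
    simpa using mul_nonneg hC (sq_nonneg h)⟩⟩

theorem of_slope (hU : IsOpen U) (hK : IsCompact K) (hKc : Convex ℝ K) (hKU : K ⊆ U)
    (hsK : s ⊆ K) (hδK : ∀ x ∈ s, ∀ h, |h| ≤ δ → x + h ∈ K)
    (hf : ContDiffOn ℝ (⊤ : ℕ∞) f U) :
    UniformExpansion s δ (fun x h => (f (x + h) - f x) / h) (deriv f)
      (fun x => deriv (deriv f) x / 2) := by
  obtain ⟨C, hC, hb⟩ := exists_uniform_taylor_bound hU hK hKc hKU hf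
  refine ⟨C, hC, fun x hx => ?_⟩
  obtain ⟨-, h1, h2, hT⟩ := hb x (hsK hx)
  refine ⟨h1, ?_, fun h hne hh => ?_⟩
  · rw [abs_div, abs_two]
    linarith
  have := (hT _ (hδK x hx h hh)).2.2
  rw [add_sub_cancel_left] at this
  have hpos : 0 < |h| := abs_pos.mpr hne
  have hrw : (f (x + h) - f x) / h - deriv f x - h * (deriv (deriv f) x / 2)
      = (f (x + h) - f x - (deriv f x * h + deriv (deriv f) x * h ^ 2 / 2)) / h := by
    field_simp
    ring
  rw [hrw, abs_div, div_le_iff₀ hpos]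
  refine this.trans_eq ?_
  rw [← sq_abs h]
  ring

theorem of_logMean (hU : IsOpen U) (hK : IsCompact K) (hKc : Convex ℝ K) (hKU : K ⊆ U)
    (hsK : s ⊆ K) (hδK : ∀ x ∈ s, ∀ h, |h| ≤ δ → x + h ∈ K)
    (hf : ContDiffOn ℝ (⊤ : ℕ∞) f U) (hpos : ∀ x ∈ K, 0 < f x) :
    UniformExpansion s δ (fun x h => logMean (f x) (f (x + h))) f
      (fun x => deriv f x / 2) := by
  obtain ⟨C, hC, hb⟩ := exists_uniform_taylor_bound hU hK hKc hKU hf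
  obtain ⟨c, hc, hlow⟩ := hK.exists_forall_le' (hf.continuousOn.mono hKU) hpos
  have hquot : 0 ≤ C ^ 2 / (4 * c) := by positivity
  refine ⟨C + C ^ 2 / (4 * c), by positivity, fun x hx => ?_⟩
  obtain ⟨h0, h1, -, hT⟩ := hb x (hsK hx)
  refine ⟨by linarith, ?_, fun h _ hh => ?_⟩
  · rw [abs_div, abs_two]
    linarith
  obtain ⟨hlip, hlin, -⟩ := hT _ (hδK x hx h hh)
  rw [add_sub_cancel_left] at hlip hlin
  rw [sq_abs] at hlin
  have hmean := abs_logMean_sub_arithMean_le hc (hlow x (hsK hx)) (hlow _ (hδK x hx h hh))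
  have hsq : (f x - f (x + h)) ^ 2 ≤ C ^ 2 * h ^ 2 := by
    rw [← sq_abs h, ← mul_pow, ← sq_abs, abs_sub_comm]
    gcongr
  have hmean' : |logMean (f x) (f (x + h)) - (f x + f (x + h)) / 2|
      ≤ C ^ 2 / (4 * c) * h ^ 2 := by
    refine hmean.trans ?_
    rw [div_mul_eq_mul_div]
    gcongr
  have hrw : logMean (f x) (f (x + h)) - f x - h * (deriv f x / 2)
      = (logMean (f x) (f (x + h)) - (f x + f (x + h)) / 2)
        + (f (x + h) - f x - deriv f x * h) / 2 := by ring
  rw [hrw]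
  refine (abs_add_le _ _).trans ?_
  rw [abs_div, abs_two]
  nlinarith [mul_nonneg hC (sq_nonneg h)]

/-- If two families have the same leading coefficient, the scaled difference of the forward value
of one and the backward value of the other is the sum of the first-order coefficients,
up to `O(h)`. -/
theorem exists_abs_sub_div_le {p q : ℝ → ℝ → ℝ} {g₀ p₁ q₁ : ℝ → ℝ}
    (hp : UniformExpansion s δ p g₀ p₁) (hq : UniformExpansion s δ q g₀ q₁) :
    ∃ C, 0 ≤ C ∧ ∀ x ∈ s, ∀ h, 0 < h → h ≤ δ →
      |(p x h - q x (-h)) / h - (p₁ x + q₁ x)| ≤ C * h := by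
  obtain ⟨A, hA, hp⟩ := hp
  obtain ⟨B, hB, hq⟩ := hq
  refine ⟨A + B, by positivity, fun x hx h h0 hh => ?_⟩
  have h1 := (hp x hx).2.2 h h0.ne' (by rwa [abs_of_pos h0])
  have h2 := (hq x hx).2.2 (-h) (neg_ne_zero.mpr h0.ne') (by rwa [abs_neg, abs_of_pos h0])
  rw [neg_sq] at h2
  have hrw : (p x h - q x (-h)) / h - (p₁ x + q₁ x)
      = ((p x h - g₀ x - h * p₁ x) - (q x (-h) - g₀ x - -h * q₁ x)) / h := by
    field_simp
    ring
  rw [hrw, abs_div, abs_of_pos h0, div_le_iff₀ h0]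
  exact (abs_sub _ _).trans (by nlinarith)

end UniformExpansion

theorem mpt_succ {N : ℕ} (i : ℕ) : mpt N (i + 1) = mpt N i + 2 / N := by
  rw [mpt, mpt]
  push_cast
  ring

/-- At an interior index the discrete drift is a difference of two fluxes. -/
theorem divg_hadamard_interior (u F ρ : ℝ → ℝ) {N i : ℕ} (hN : 0 < N) (hi : 2 ≤ i)
    (hiN : i ≤ N) {a : Fin (N + 1)} (ha : (a : ℕ) = i - 1) :
    divg u N (Matrix.hadamard (rhoHat ρ N) (gradMat F N)) a
      = (u (mpt N i + 2 / N) * logMean (ρ (mpt N i)) (ρ (mpt N i + 2 / N))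
            * ((F (mpt N i + 2 / N) - F (mpt N i)) / (2 / N))
          - u (mpt N i) * logMean (ρ (mpt N i)) (ρ (mpt N i + -(2 / N)))
            * ((F (mpt N i + -(2 / N)) - F (mpt N i)) / -(2 / N))) / (2 / N) := by
  obtain ⟨k, rfl⟩ : ∃ k, i = k + 2 := ⟨i - 2, by omega⟩
  have hback : mpt N (k + 2) + -(2 / N) = mpt N (k + 1) := by
    rw [mpt_succ (k + 1)]
    ring
  rw [hback, ← mpt_succ]
  have hN' : (N : ℝ) ≠ 0 := by positivity
  let l : Fin (N + 1) := ⟨k, by omega⟩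
  let c : Fin (N + 1) := ⟨k + 1, by omega⟩
  let r : Fin (N + 1) := ⟨k + 2, by omega⟩
  have hac : a = c := Fin.ext (by simp [ha, c])
  have hlr : l ≠ r := by simp [l, r, Fin.ext_iff]
  have hsum : ∑ b, Kmat u N c b * Matrix.hadamard (rhoHat ρ N) (gradMat F N) c b
      = Kmat u N c l * Matrix.hadamard (rhoHat ρ N) (gradMat F N) c l
        + Kmat u N c r * Matrix.hadamard (rhoHat ρ N) (gradMat F N) c r := by
    refine Fintype.sum_eq_add l r hlr fun b hb => ?_
    by_cases hbc : b = c
    · subst hbc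
      simp [gradMat]
    · have h1 : (b : ℕ) ≠ k + 1 + 1 := fun h => hb.2 (Fin.ext h)
      have h2 : k + 1 ≠ (b : ℕ) + 1 := fun h => hb.1 (Fin.ext (by simp [l]; omega))
      have h3 : c ≠ b := fun h => hbc h.symm
      have hK : Kmat u N c b = 0 := by
        unfold Kmat
        rw [if_neg h1, if_neg h2, if_neg h3]
      rw [hK, zero_mul]
  rw [hac, divg, hsum]
  have hKl : Kmat u N c l = u (mpt N (k + 2)) := by
    have hne : k ≠ k + 1 + 1 := by omega
    simp [Kmat, c, l, hne]
  have hKr : Kmat u N c r = u (mpt N (k + 2 + 1)) := by simp [Kmat, c, r]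
  rw [hKl, hKr]
  simp only [Matrix.hadamard_apply, rhoHat, gradMat, c, l, r]
  field_simp
  ring

/-- A rate `C / N` valid for all large `N` holds for all `N ≥ 1` after enlarging `C`. -/
theorem exists_rate_of_eventual_rate {P : ℕ → ℕ → Prop} {e : ℕ → ℕ → ℝ} {C : ℝ} {N₀ : ℕ}
    (h : ∀ N, N₀ ≤ N → ∀ i, i ≤ N → P N i → e N i ≤ C / N) :
    ∃ C' > 0, ∀ N, 1 ≤ N → ∀ i, i ≤ N → P N i → e N i ≤ C' / N := by
  have hS : 0 ≤ ∑ N ∈ range N₀, ∑ i ∈ range (N + 1), (N : ℝ) * |e N i| := by positivity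
  refine ⟨|C| + 1 + ∑ N ∈ range N₀, ∑ i ∈ range (N + 1), (N : ℝ) * |e N i|, by positivity,
    fun N hN i hi hP => ?_⟩
  have hN' : (0 : ℝ) < N := by exact_mod_cast hN
  rcases le_or_gt N₀ N with hle | hlt
  · refine (h N hle i hi hP).trans ?_
    gcongr
    linarith [le_abs_self C]
  · rw [le_div_iff₀ hN']
    have h1 : (N : ℝ) * |e N i| ≤ ∑ j ∈ range (N + 1), (N : ℝ) * |e N j| :=
      single_le_sum (f := fun j => (N : ℝ) * |e N j|) (fun j _ => by positivity)
        (mem_range.mpr (by omega))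
    have h2 : ∑ j ∈ range (N + 1), (N : ℝ) * |e N j|
        ≤ ∑ M ∈ range N₀, ∑ j ∈ range (M + 1), (M : ℝ) * |e M j| :=
      single_le_sum (f := fun M : ℕ => ∑ j ∈ range (M + 1), (M : ℝ) * |e M j|)
        (fun M _ => by positivity) (mem_range.mpr hlt)
    nlinarith [le_abs_self (e N i), abs_nonneg C]

/-- The discrete Fokker–Planck drift `[∇∇(ρ̂ ⊙ ∇F)]_i` converges
to `(u·ρ·F')'(m_i)` at rate `O(1/N)`, uniformly over indices `i` with
`m_i` in any compact interval `[a₀, a₁] ⊂ (−1,1)`. -/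
theorem discrete_fokker_planck_drift_asymptotics
    (u F ρ : ℝ → ℝ)
    (hu : ContDiffOn ℝ (⊤ : ℕ∞) u (Set.Icc (-1 : ℝ) 1))
    (hu01 : ∀ m ∈ Set.Icc (-1 : ℝ) 1, u m ∈ Set.Ioo (0 : ℝ) (1 / 2))
    (hF : ContDiffOn ℝ (⊤ : ℕ∞) F (Set.Ioo (-1 : ℝ) 1))
    (hρ : ContDiffOn ℝ (⊤ : ℕ∞) ρ (Set.Icc (-1 : ℝ) 1))
    (hρpos : ∀ m ∈ Set.Icc (-1 : ℝ) 1, 0 < ρ m)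
    (a₀ a₁ : ℝ) (ha₀ : -1 < a₀) (ha₁ : a₁ < 1) :
    ∃ C > 0, ∀ N : ℕ, 2 ≤ N → ∀ i : ℕ, ∀ _ : 2 ≤ i, ∀ hiN : i ≤ N,
      mpt N i ∈ Set.Icc a₀ a₁ →
      |divg u N (Matrix.hadamard (rhoHat ρ N) (gradMat F N)) ⟨i - 1, by omega⟩
          - deriv (fun m => u m * ρ m * deriv F m) (mpt N i)| ≤ C / N := by
  set δ : ℝ := min 1 (min ((a₀ + 1) / 2) ((1 - a₁) / 2)) with hδdef
  have hδ0 : 0 < δ := lt_min one_pos (lt_min (by linarith) (by linarith))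
  have hδ1 : δ ≤ 1 := min_le_left _ _
  have hδ2 : δ ≤ (a₀ + 1) / 2 := (min_le_right _ _).trans (min_le_left _ _)
  have hδ3 : δ ≤ (1 - a₁) / 2 := (min_le_right _ _).trans (min_le_right _ _)
  set U : Set ℝ := Set.Ioo (-1) 1
  set K : Set ℝ := Set.Icc (a₀ - δ) (a₁ + δ)
  set s : Set ℝ := Set.Icc a₀ a₁
  have hU : IsOpen U := isOpen_Ioo
  have hK : IsCompact K := isCompact_Icc
  have hKc : Convex ℝ K := convex_Icc _ _
  have hKU : K ⊆ U := Set.Icc_subset_Ioo (by linarith) (by linarith)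
  have hUI : U ⊆ Set.Icc (-1) 1 := Set.Ioo_subset_Icc_self
  have hsK : s ⊆ K := Set.Icc_subset_Icc (by linarith) (by linarith)
  have hδK : ∀ x ∈ s, ∀ h, |h| ≤ δ → x + h ∈ K := fun x hx h hh =>
    ⟨by linarith [hx.1, (abs_le.mp hh).1], by linarith [hx.2, (abs_le.mp hh).2]⟩
  have hu' := hu.mono hUI
  have hρ' := hρ.mono hUI
  have hF' := ((contDiffOn_infty_iff_deriv_of_isOpen hU).mp hF).2
  have hmean := UniformExpansion.of_logMean hU hK hKc hKU hsK hδK hρ'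
    (fun x hx => hρpos x (hUI (hKU hx)))
  have hslope := UniformExpansion.of_slope hU hK hKc hKU hsK hδK hF
  have hforward := ((UniformExpansion.of_shift hU hK hKc hKU hsK hδK hu').mul hδ1 hmean).mul
    hδ1 hslope
  have hbackward := ((UniformExpansion.of_const hK hKU hsK hu').mul hδ1 hmean).mul hδ1 hslope
  obtain ⟨C, hC, hbound⟩ := hforward.exists_abs_sub_div_le hbackward
  have hderiv : ∀ x ∈ s, deriv (fun m => u m * ρ m * deriv F m) x
      = u x * ρ x * (deriv (deriv F) x / 2)
          + (u x * (deriv ρ x / 2) + deriv u x * ρ x) * deriv F x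
        + (u x * ρ x * (deriv (deriv F) x / 2)
          + (u x * (deriv ρ x / 2) + (0 : ℝ → ℝ) x * ρ x) * deriv F x) := by
    intro x hx
    have hxU := hKU (hsK hx)
    have h := ((hu'.hasDerivAt_deriv hU hxU).mul (hρ'.hasDerivAt_deriv hU hxU)).mul
      (hF'.hasDerivAt_deriv hU hxU)
    refine h.deriv.trans ?_
    simp only [Pi.zero_apply, Pi.mul_apply]
    ring
  obtain ⟨N₀, hN₀⟩ := exists_nat_ge (2 / δ)
  obtain ⟨C', hC', hrate⟩ := exists_rate_of_eventual_rate (N₀ := N₀ + 1) (C := 2 * C)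
    (P := fun N i => mpt N i ∈ s)
    (e := fun N i =>
      |(u (mpt N i + 2 / N) * logMean (ρ (mpt N i)) (ρ (mpt N i + 2 / N))
            * ((F (mpt N i + 2 / N) - F (mpt N i)) / (2 / N))
          - u (mpt N i) * logMean (ρ (mpt N i)) (ρ (mpt N i + -(2 / N)))
            * ((F (mpt N i + -(2 / N)) - F (mpt N i)) / -(2 / N))) / (2 / N)
        - deriv (fun m => u m * ρ m * deriv F m) (mpt N i)|)
    (by
      intro N hN i _ hi
      have hNpos : (0 : ℝ) < N := by exact_mod_cast (Nat.succ_pos N₀).trans_le hN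
      have hNle : 2 / δ ≤ N := hN₀.trans (by exact_mod_cast (Nat.le_succ N₀).trans hN)
      have hstep : 2 / (N : ℝ) ≤ δ := by
        rw [div_le_iff₀ hδ0] at hNle
        rw [div_le_iff₀ hNpos]
        linarith
      rw [hderiv _ hi]
      exact (hbound _ hi (2 / N) (by positivity) hstep).trans_eq (by ring))
  refine ⟨C', hC', fun N hN i hi hiN hmem => ?_⟩
  rw [divg_hadamard_interior u F ρ (by omega) hi hiN rfl]
  exact hrate N (by omega) i hiN hmem
end
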